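/- arXiv:2603.08368 — 8 statements merged into one kernel-verified Lean document; each statement's English description precedes it below -/
import Mathlib

section
/- For every s ≥ 0 and every ε ∈ (0, 1/6] there exist δ ∈ (0,1) and C > 0 with the following property: for all real numbers ξ₀,…,ξ₄ and integers q₀,…,q₄ satisfying the convolution constraint, the ordering |(ξ₁,q₁)| ≥ |(ξ₂,q₂)| ≥ |(ξ₃,q₃)| ≥ |(ξ₄,q₄)|, as well as |(ξ₁,q₁)| ≥ 1/δ, |(ξ₄,q₄)| ≤ δ|(ξ₁,q₁)| and |(ξ₃,q₃)| ≤ δ|(ξ₀,q₀)|, one has |ξ₀| ⟨(ξ₀,q₀)⟩^s ≤ C · ||(ξ₁,q₁)|² − |(ξ₄,q₄)|²|^(1/2) ⟨(ξ₁,q₁)⟩^s ⟨(ξ₄,q₄)⟩^(−1/6) · ||(ξ₀,q₀)|² − |(ξ₃,q₃)|²|^(1/2) ⟨(ξ₀,q₀)⟩^(−ε) ⟨(ξ₃,q₃)⟩^(−1/6) ⟨(ξ₂,q₂)⟩^(−2/3+ε). -/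
/-- The weighted norm `|(ξ,q)| = (3ξ² + q²)^(1/2)` for `(ξ,q) ∈ ℝ × ℤ`. -/
noncomputable def wnorm (ξ : ℝ) (q : ℤ) : ℝ := Real.sqrt (3 * ξ ^ 2 + (q : ℝ) ^ 2)

/-- The Japanese bracket `⟨(ξ,q)⟩ = (1 + ξ² + q²)^(1/2)` for `(ξ,q) ∈ ℝ × ℤ`. -/
noncomputable def jb (ξ : ℝ) (q : ℤ) : ℝ := Real.sqrt (1 + ξ ^ 2 + (q : ℝ) ^ 2)

theorem wnorm_nonneg (ξ : ℝ) (q : ℤ) : 0 ≤ wnorm ξ q := Real.sqrt_nonneg _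

theorem wnorm_sq (ξ : ℝ) (q : ℤ) : wnorm ξ q ^ 2 = 3 * ξ ^ 2 + (q : ℝ) ^ 2 :=
  Real.sq_sqrt (by positivity)

theorem jb_pos (ξ : ℝ) (q : ℤ) : 0 < jb ξ q := Real.sqrt_pos.2 (by positivity)

theorem jb_sq (ξ : ℝ) (q : ℤ) : jb ξ q ^ 2 = 1 + ξ ^ 2 + (q : ℝ) ^ 2 :=
  Real.sq_sqrt (by positivity)

theorem abs_le_wnorm (ξ : ℝ) (q : ℤ) : |ξ| ≤ wnorm ξ q :=
  abs_le_of_sq_le_sq (by rw [wnorm_sq]; nlinarith [sq_nonneg ξ, sq_nonneg (q : ℝ)])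
    (wnorm_nonneg ξ q)

theorem wnorm_le_two_mul_jb (ξ : ℝ) (q : ℤ) : wnorm ξ q ≤ 2 * jb ξ q := by
  refine le_of_sq_le_sq ?_ (by linarith [jb_pos ξ q])
  rw [mul_pow, wnorm_sq, jb_sq]
  nlinarith [sq_nonneg ξ, sq_nonneg (q : ℝ)]

theorem jb_le_five_mul {ξ : ℝ} {q : ℤ} {N : ℝ} (hN : 1 ≤ N) (h : wnorm ξ q ≤ 4 * N) :
    jb ξ q ≤ 5 * N := by
  refine le_of_sq_le_sq ?_ (by linarith)
  have h2 : wnorm ξ q ^ 2 ≤ (4 * N) ^ 2 := pow_le_pow_left₀ (wnorm_nonneg ξ q) h 2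
  rw [wnorm_sq] at h2
  rw [jb_sq]
  nlinarith [sq_nonneg ξ]

theorem sq_add_four_le (a b c d : ℝ) :
    (a + b + c + d) ^ 2 ≤ 4 * (a ^ 2 + b ^ 2 + c ^ 2 + d ^ 2) := by
  nlinarith [sq_nonneg (a - b), sq_nonneg (a - c), sq_nonneg (a - d), sq_nonneg (b - c),
    sq_nonneg (b - d), sq_nonneg (c - d)]

/-- If four frequencies have weighted norm at most `N`, their sum has norm at most `4 * N`. -/
theorem wnorm_add_four_le {ξ₁ ξ₂ ξ₃ ξ₄ : ℝ} {q₁ q₂ q₃ q₄ : ℤ} {N : ℝ}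
    (h₁ : wnorm ξ₁ q₁ ≤ N) (h₂ : wnorm ξ₂ q₂ ≤ N) (h₃ : wnorm ξ₃ q₃ ≤ N)
    (h₄ : wnorm ξ₄ q₄ ≤ N) :
    wnorm (ξ₁ + ξ₂ + ξ₃ + ξ₄) (q₁ + q₂ + q₃ + q₄) ≤ 4 * N := by
  have hsq {ξ : ℝ} {q : ℤ} (h : wnorm ξ q ≤ N) : 3 * ξ ^ 2 + (q : ℝ) ^ 2 ≤ N ^ 2 :=
    wnorm_sq ξ q ▸ pow_le_pow_left₀ (wnorm_nonneg ξ q) h 2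
  refine le_of_sq_le_sq ?_ (by linarith [wnorm_nonneg ξ₁ q₁])
  rw [wnorm_sq]
  push_cast
  linarith [sq_add_four_le ξ₁ ξ₂ ξ₃ ξ₄, sq_add_four_le (q₁ : ℝ) q₂ q₃ q₄,
    hsq h₁, hsq h₂, hsq h₃, hsq h₄]

theorem half_le_rpow_abs_sq_sub_sq {a b : ℝ} (hb : 0 ≤ b)
    (h : b ≤ 1 / 2 * a) : a / 2 ≤ |a ^ 2 - b ^ 2| ^ ((1 : ℝ) / 2) := by
  rw [← Real.sqrt_eq_rpow]
  apply Real.le_sqrt_of_sq_le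
  refine le_trans ?_ (le_abs_self _)
  nlinarith [pow_le_pow_left₀ hb h 2]

theorem stmt_1 (s : ℝ) (hs : 0 ≤ s) (ε : ℝ) (hε : 0 < ε ∧ ε ≤ 1 / 6) :
    ∃ δ : ℝ, δ ∈ Set.Ioo (0 : ℝ) 1 ∧ ∃ C : ℝ, 0 < C ∧
      ∀ (ξ₀ ξ₁ ξ₂ ξ₃ ξ₄ : ℝ) (q₀ q₁ q₂ q₃ q₄ : ℤ),
        ξ₀ = ξ₁ + ξ₂ + ξ₃ + ξ₄ → q₀ = q₁ + q₂ + q₃ + q₄ →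
        wnorm ξ₂ q₂ ≤ wnorm ξ₁ q₁ → wnorm ξ₃ q₃ ≤ wnorm ξ₂ q₂ →
        wnorm ξ₄ q₄ ≤ wnorm ξ₃ q₃ →
        1 / δ ≤ wnorm ξ₁ q₁ →
        wnorm ξ₄ q₄ ≤ δ * wnorm ξ₁ q₁ →
        wnorm ξ₃ q₃ ≤ δ * wnorm ξ₀ q₀ →
        |ξ₀| * jb ξ₀ q₀ ^ s ≤
          C * (|wnorm ξ₁ q₁ ^ 2 - wnorm ξ₄ q₄ ^ 2| ^ ((1 : ℝ) / 2) *
            jb ξ₁ q₁ ^ s * jb ξ₄ q₄ ^ (-(1 : ℝ) / 6) *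
            |wnorm ξ₀ q₀ ^ 2 - wnorm ξ₃ q₃ ^ 2| ^ ((1 : ℝ) / 2) *
            jb ξ₀ q₀ ^ (-ε) * jb ξ₃ q₃ ^ (-(1 : ℝ) / 6) *
            jb ξ₂ q₂ ^ (-(2 : ℝ) / 3 + ε)) := by
  obtain ⟨hε0, hε1⟩ := hε
  refine ⟨1 / 2, by norm_num, 20 * 10 ^ s, by positivity, ?_⟩
  intro ξ₀ ξ₁ ξ₂ ξ₃ ξ₄ q₀ q₁ q₂ q₃ q₄ hξ hq h21 h32 h43 h1 h41 h30
  have h31 := h32.trans h21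
  have h1' : 1 ≤ wnorm ξ₁ q₁ := by norm_num at h1; linarith
  have h01 : wnorm ξ₀ q₀ ≤ 4 * wnorm ξ₁ q₁ :=
    hξ ▸ hq ▸ wnorm_add_four_le le_rfl h21 h31 (h43.trans h31)
  have hd14 := half_le_rpow_abs_sq_sub_sq (wnorm_nonneg ξ₄ q₄) h41
  have hd03 := half_le_rpow_abs_sq_sub_sq (wnorm_nonneg ξ₃ q₃) h30
  have hJ0 := jb_le_five_mul h1' h01
  have hneg {ξ : ℝ} {q : ℤ} {r : ℝ} (h : wnorm ξ q ≤ 4 * wnorm ξ₁ q₁) (hr : r ≤ 0) :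
      (5 * wnorm ξ₁ q₁) ^ r ≤ jb ξ q ^ r :=
    Real.rpow_le_rpow_of_nonpos (jb_pos ξ q) (jb_le_five_mul h1' h) hr
  have h4 := hneg (ξ := ξ₄) (q := q₄) (r := -(1 : ℝ) / 6) (by linarith) (by norm_num)
  have h0 := hneg (r := -ε) h01 (by linarith)
  have h3 := hneg (ξ := ξ₃) (q := q₃) (r := -(1 : ℝ) / 6) (by linarith) (by norm_num)
  have h2 := hneg (ξ := ξ₂) (q := q₂) (r := -(2 : ℝ) / 3 + ε) (by linarith) (by linarith)
  have hs0 : jb ξ₀ q₀ ^ s ≤ 10 ^ s * jb ξ₁ q₁ ^ s := by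
    rw [← Real.mul_rpow (by norm_num) (jb_pos ξ₁ q₁).le]
    exact Real.rpow_le_rpow (jb_pos ξ₀ q₀).le
      (by linarith [wnorm_le_two_mul_jb ξ₁ q₁]) hs
  have hJ1 := (jb_pos ξ₁ q₁).le
  have hN0 := wnorm_nonneg ξ₀ q₀
  set N := wnorm ξ₁ q₁
  have hN : 0 < N := by linarith
  have hprod : (5 * N) ^ (-(1 : ℝ) / 6) * (5 * N) ^ (-ε) * (5 * N) ^ (-(1 : ℝ) / 6) *
      (5 * N) ^ (-(2 : ℝ) / 3 + ε) = (5 * N)⁻¹ := by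
    have h5 : 0 < 5 * N := by linarith
    rw [← Real.rpow_add h5, ← Real.rpow_add h5, ← Real.rpow_add h5, ← Real.rpow_neg_one]
    congr 1
    ring
  have hJ0' := jb_pos ξ₀ q₀
  have hJ3' := jb_pos ξ₃ q₃
  have hJ4' := jb_pos ξ₄ q₄
  calc |ξ₀| * jb ξ₀ q₀ ^ s
      ≤ wnorm ξ₀ q₀ * (10 ^ s * jb ξ₁ q₁ ^ s) :=
        mul_le_mul (abs_le_wnorm ξ₀ q₀) hs0 (by positivity) hN0
    _ = 20 * 10 ^ s * (N / 2 * jb ξ₁ q₁ ^ s * (wnorm ξ₀ q₀ / 2) * (5 * N)⁻¹) := by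
        field_simp
        ring
    _ = 20 * 10 ^ s * (N / 2 * jb ξ₁ q₁ ^ s * (5 * N) ^ (-(1 : ℝ) / 6) *
          (wnorm ξ₀ q₀ / 2) * (5 * N) ^ (-ε) * (5 * N) ^ (-(1 : ℝ) / 6) *
          (5 * N) ^ (-(2 : ℝ) / 3 + ε)) := by
        rw [← hprod]
        ring
    _ ≤ _ := by gcongr
end

section
/- For every s ≥ 0, every ε ∈ (0, 1/6] and every L ≥ 1 there exist δ ∈ (0,1) and C > 0 with the following property: for all real numbers ξ₀,…,ξ₄ and integers q₀,…,q₄ satisfying the convolution constraint, the ordering |(ξ₁,q₁)| ≥ |(ξ₂,q₂)| ≥ |(ξ₃,q₃)| ≥ |(ξ₄,q₄)|, as well as |(ξ₁,q₁)| ≥ 1/δ, |(ξ₄,q₄)| ≤ δ|(ξ₁,q₁)| and |(ξ₀,q₀)| ≤ L|(ξ₃,q₃)|, one has |ξ₀| ⟨(ξ₀,q₀)⟩^s ≤ C · ||(ξ₁,q₁)|² − |(ξ₄,q₄)|²|^(1/2) ⟨(ξ₁,q₁)⟩^s ⟨(ξ₄,q₄)⟩^(−7/54) · |ξ₀|^(1/6)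 ⟨(ξ₀,q₀)⟩^(−1/3−ε) ⟨(ξ₂,q₂)⟩^(4/27+2ε) ⟨(ξ₃,q₃)⟩^(4/27+2ε). -/
theorem one_le_jb (ξ : ℝ) (q : ℤ) : 1 ≤ jb ξ q :=
  Real.one_le_sqrt.2 (by nlinarith [sq_nonneg ξ, sq_nonneg (q : ℝ)])

theorem abs_le_jb (ξ : ℝ) (q : ℤ) : |ξ| ≤ jb ξ q :=
  Real.abs_le_sqrt (by nlinarith [sq_nonneg (q : ℝ)])

/-- Comparability of the weighted norms carries over to the Japanese brackets. -/
theorem jb_le_of_wnorm_le {L ξ η : ℝ} {q r : ℤ} (hL : 1 ≤ L)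
    (h : wnorm ξ q ≤ L * wnorm η r) : jb ξ q ≤ 2 * L * jb η r := by
  have hj := one_le_jb η r
  refine le_of_abs_le (abs_le_of_sq_le_sq ?_ (by positivity))
  have h2 := pow_le_pow_left₀ (wnorm_nonneg ξ q) h 2
  rw [mul_pow, wnorm_sq, wnorm_sq] at h2
  rw [mul_pow, jb_sq, jb_sq]
  have hL2 : 1 ≤ L ^ 2 := one_le_pow₀ hL
  nlinarith [sq_nonneg ξ, mul_nonneg (sq_nonneg L) (sq_nonneg η),
    mul_nonneg (sq_nonneg L) (sq_nonneg (r : ℝ))]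

/-- The resonance weight controls the larger frequency when the frequencies are separated. -/
theorem jb_le_two_mul_sqrt_abs_sub {ξ η : ℝ} {q r : ℤ} (h : 2 ≤ wnorm ξ q)
    (h' : wnorm η r ≤ 1 / 2 * wnorm ξ q) :
    jb ξ q ≤ 2 * |wnorm ξ q ^ 2 - wnorm η r ^ 2| ^ ((1 : ℝ) / 2) := by
  rw [← Real.sqrt_eq_rpow]
  refine le_of_abs_le (abs_le_of_sq_le_sq ?_ (by positivity))
  rw [mul_pow, Real.sq_sqrt (abs_nonneg _), jb_sq]
  have h1 := pow_le_pow_left₀ (wnorm_nonneg η r) h' 2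
  have h2 := le_abs_self (wnorm ξ q ^ 2 - wnorm η r ^ 2)
  have h3 := wnorm_sq ξ q
  nlinarith [sq_nonneg ξ]

theorem stmt_2 (s : ℝ) (hs : 0 ≤ s) (ε : ℝ) (hε : 0 < ε ∧ ε ≤ 1 / 6)
    (L : ℝ) (hL : 1 ≤ L) :
    ∃ δ : ℝ, δ ∈ Set.Ioo (0 : ℝ) 1 ∧ ∃ C : ℝ, 0 < C ∧
      ∀ (ξ₀ ξ₁ ξ₂ ξ₃ ξ₄ : ℝ) (q₀ q₁ q₂ q₃ q₄ : ℤ),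
        ξ₀ = ξ₁ + ξ₂ + ξ₃ + ξ₄ → q₀ = q₁ + q₂ + q₃ + q₄ →
        wnorm ξ₂ q₂ ≤ wnorm ξ₁ q₁ → wnorm ξ₃ q₃ ≤ wnorm ξ₂ q₂ →
        wnorm ξ₄ q₄ ≤ wnorm ξ₃ q₃ →
        1 / δ ≤ wnorm ξ₁ q₁ →
        wnorm ξ₄ q₄ ≤ δ * wnorm ξ₁ q₁ →
        wnorm ξ₀ q₀ ≤ L * wnorm ξ₃ q₃ →
        |ξ₀| * jb ξ₀ q₀ ^ s ≤
          C * (|wnorm ξ₁ q₁ ^ 2 - wnorm ξ₄ q₄ ^ 2| ^ ((1 : ℝ) / 2) *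
            jb ξ₁ q₁ ^ s * jb ξ₄ q₄ ^ (-(7 : ℝ) / 54) *
            |ξ₀| ^ ((1 : ℝ) / 6) * jb ξ₀ q₀ ^ (-(1 : ℝ) / 3 - ε) *
            jb ξ₂ q₂ ^ ((4 : ℝ) / 27 + 2 * ε) *
            jb ξ₃ q₃ ^ ((4 : ℝ) / 27 + 2 * ε)) := by
  obtain ⟨hε, -⟩ := hε
  refine ⟨1 / 2, by norm_num, (2 * L) ^ (7 / 6 + s + ε) * (4 * 2 ^ s * 2 ^ ((7 : ℝ) / 54) *
    2 ^ ((4 : ℝ) / 27 + 2 * ε)), by positivity, ?_⟩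
  intro ξ₀ ξ₁ ξ₂ ξ₃ ξ₄ q₀ q₁ q₂ q₃ q₄ _ _ h21 h32 h43 h1 h41 h03
  have hM := jb_le_two_mul_sqrt_abs_sub (by linarith) h41
  have j03 := jb_le_of_wnorm_le hL h03
  have j43 := jb_le_of_wnorm_le le_rfl (h43.trans_eq (one_mul _).symm)
  have j32 := jb_le_of_wnorm_le le_rfl (h32.trans_eq (one_mul _).symm)
  have j31 := jb_le_of_wnorm_le le_rfl ((h32.trans h21).trans_eq (one_mul _).symm)
  have hx := abs_le_jb ξ₀ q₀
  have p0 := one_le_jb ξ₀ q₀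
  have p1 := one_le_jb ξ₁ q₁
  have p2 := one_le_jb ξ₂ q₂
  have p3 := one_le_jb ξ₃ q₃
  have p4 := one_le_jb ξ₄ q₄
  have hx0 := abs_nonneg ξ₀
  rw [mul_one] at j43 j32 j31
  generalize |wnorm ξ₁ q₁ ^ 2 - wnorm ξ₄ q₄ ^ 2| ^ ((1 : ℝ) / 2) = M at *
  generalize jb ξ₀ q₀ = a at *
  generalize jb ξ₁ q₁ = b at *
  generalize jb ξ₂ q₂ = c at *
  generalize jb ξ₃ q₃ = d at *
  generalize jb ξ₄ q₄ = e at *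
  generalize |ξ₀| = x at *
  have ha : 0 < a := by linarith
  have hb : 0 < b := by linarith
  have hc : 0 < c := by linarith
  have hd : 0 < d := by linarith
  have he : 0 < e := by linarith
  have hM0 : 0 < M := by linarith
  have ex : x = x ^ ((1 : ℝ) / 6) * x ^ ((5 : ℝ) / 6) := by
    rw [← Real.rpow_add_of_nonneg hx0 (by norm_num) (by norm_num)]
    norm_num
  have ea : a ^ ((5 : ℝ) / 6) * a ^ s = a ^ (7 / 6 + s + ε) * a ^ (-(1 : ℝ) / 3 - ε) := by
    rw [← Real.rpow_add ha, ← Real.rpow_add ha]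
    ring_nf
  have ed : d ^ (7 / 6 + s + 4 * ε) = d * d ^ s * d ^ (-(7 : ℝ) / 54) *
      d ^ ((4 : ℝ) / 27 + 2 * ε) * d ^ ((4 : ℝ) / 27 + 2 * ε) := by
    nth_rw 2 [← Real.rpow_one d]
    simp only [← Real.rpow_add hd]
    ring_nf
  have k1 : d ≤ 4 * M := by linarith
  have k2 : d ^ s ≤ 2 ^ s * b ^ s := by
    rw [← Real.mul_rpow zero_le_two hb.le]
    gcongr
  have k3 : d ^ (-(7 : ℝ) / 54) ≤ 2 ^ ((7 : ℝ) / 54) * e ^ (-(7 : ℝ) / 54) := by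
    rw [neg_div, Real.rpow_neg hd.le, Real.rpow_neg he.le, ← div_eq_mul_inv,
      inv_le_iff_one_le_mul₀ (by positivity), div_mul_eq_mul_div,
      ← Real.mul_rpow zero_le_two hd.le, one_le_div (by positivity)]
    gcongr
  have k4 : d ^ ((4 : ℝ) / 27 + 2 * ε) ≤
      2 ^ ((4 : ℝ) / 27 + 2 * ε) * c ^ ((4 : ℝ) / 27 + 2 * ε) := by
    rw [← Real.mul_rpow zero_le_two hc.le]
    gcongr
  calc x * a ^ s = x ^ ((1 : ℝ) / 6) * x ^ ((5 : ℝ) / 6) * a ^ s := by rw [← ex]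
    _ ≤ x ^ ((1 : ℝ) / 6) * a ^ ((5 : ℝ) / 6) * a ^ s := by gcongr
    _ = x ^ ((1 : ℝ) / 6) * a ^ (-(1 : ℝ) / 3 - ε) * a ^ (7 / 6 + s + ε) := by
      rw [mul_assoc, ea]; ring
    _ ≤ x ^ ((1 : ℝ) / 6) * a ^ (-(1 : ℝ) / 3 - ε) * (2 * L * d) ^ (7 / 6 + s + ε) := by gcongr
    _ = x ^ ((1 : ℝ) / 6) * a ^ (-(1 : ℝ) / 3 - ε) *
        ((2 * L) ^ (7 / 6 + s + ε) * d ^ (7 / 6 + s + ε)) := by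
      rw [Real.mul_rpow (by positivity) hd.le]
    _ ≤ x ^ ((1 : ℝ) / 6) * a ^ (-(1 : ℝ) / 3 - ε) *
        ((2 * L) ^ (7 / 6 + s + ε) * d ^ (7 / 6 + s + 4 * ε)) := by
      gcongr
      linarith
    _ ≤ x ^ ((1 : ℝ) / 6) * a ^ (-(1 : ℝ) / 3 - ε) * ((2 * L) ^ (7 / 6 + s + ε) *
        (4 * M * (2 ^ s * b ^ s) * (2 ^ ((7 : ℝ) / 54) * e ^ (-(7 : ℝ) / 54)) *
          (2 ^ ((4 : ℝ) / 27 + 2 * ε) * c ^ ((4 : ℝ) / 27 + 2 * ε)) *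
          d ^ ((4 : ℝ) / 27 + 2 * ε))) := by
      rw [ed]
      gcongr
    _ = _ := by ring
end

section
/- For every s ≥ 0, every ε ∈ (0, 1/6] and every γ ∈ (0,1) there exists C > 0 with the following property: for all distinct indices i, j ∈ {1,2,3,4} and all real numbers ξ₀,…,ξ₄ and integers q₀,…,q₄ satisfying the convolution constraint, the ordering |(ξ₁,q₁)| ≥ |(ξ₂,q₂)| ≥ |(ξ₃,q₃)| ≥ |(ξ₄,q₄)|, as well as |(ξ₁,q₁)| ≥ 1, |(ξ₄,q₄)| ≥ γ|(ξ₁,q₁)| and ||(ξᵢ,qᵢ)|² − |(ξⱼ,qⱼ)|²| ≥ γ|(ξ₁,q₁)|², one has |ξ₀| ⟨(ξ₀,q₀)⟩^s ≤ C · ||(ξᵢ,qᵢ)|² − |(ξⱼ,qⱼ)|²|^(1/2) ⟨(ξᵢ,qᵢ)⟩^s ⟨(ξⱼ,qⱼ)⟩^(−7/54) · |ξ₀|^(1/6) ⟨(ξ₀,q₀)⟩^(−1/3−ε) · ∏_{k ∈ {1,2,3,4} \ {i,j}} ⟨(ξ_k,q_k)⟩^(4/27+2ε). -/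
theorem jb_le_two_mul {ξ : ℝ} {q : ℤ} {N : ℝ} (hN : 1 ≤ N) (h : wnorm ξ q ≤ N) :
    jb ξ q ≤ 2 * N := by
  refine Real.sqrt_le_iff.2 ⟨by linarith, ?_⟩
  nlinarith [wnorm_sq ξ q, wnorm_nonneg ξ q, sq_nonneg ξ]

theorem half_wnorm_le_jb (ξ : ℝ) (q : ℤ) : wnorm ξ q / 2 ≤ jb ξ q := by
  refine Real.le_sqrt_of_sq_le ?_
  nlinarith [wnorm_sq ξ q, sq_nonneg ξ, sq_nonneg (q : ℝ)]

theorem abs_fst_le_of_wnorm_le {ξ : ℝ} {q : ℤ} {N : ℝ} (h : wnorm ξ q ≤ N) : |ξ| ≤ N := by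
  refine le_trans (abs_le_of_sq_le_sq ?_ (wnorm_nonneg ξ q)) h
  nlinarith [wnorm_sq ξ q, sq_nonneg ξ, sq_nonneg (q : ℝ)]

theorem abs_snd_le_of_wnorm_le {ξ : ℝ} {q : ℤ} {N : ℝ} (h : wnorm ξ q ≤ N) :
    |(q : ℝ)| ≤ N := by
  refine le_trans (abs_le_of_sq_le_sq ?_ (wnorm_nonneg ξ q)) h
  nlinarith [wnorm_sq ξ q, sq_nonneg ξ]

theorem jb_sum_four_le {ξ : Fin 5 → ℝ} {q : Fin 5 → ℤ} {N : ℝ} (hN : 1 ≤ N)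
    (hξ : ξ 0 = ξ 1 + ξ 2 + ξ 3 + ξ 4) (hq : q 0 = q 1 + q 2 + q 3 + q 4)
    (h : ∀ k ∈ ({1, 2, 3, 4} : Finset (Fin 5)), wnorm (ξ k) (q k) ≤ N) :
    jb (ξ 0) (q 0) ≤ 6 * N := by
  have a (k) (hk : k ∈ ({1, 2, 3, 4} : Finset (Fin 5))) :=
    abs_le.1 (abs_fst_le_of_wnorm_le (h k hk))
  have b (k) (hk : k ∈ ({1, 2, 3, 4} : Finset (Fin 5))) :=
    abs_le.1 (abs_snd_le_of_wnorm_le (h k hk))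
  have a1 := a 1 (by decide)
  have a2 := a 2 (by decide)
  have a3 := a 3 (by decide)
  have a4 := a 4 (by decide)
  have b1 := b 1 (by decide)
  have b2 := b 2 (by decide)
  have b3 := b 3 (by decide)
  have b4 := b 4 (by decide)
  have hq' : (q 0 : ℝ) = q 1 + q 2 + q 3 + q 4 := by exact_mod_cast hq
  have hx : ξ 0 ^ 2 ≤ (4 * N) ^ 2 := sq_le_sq' (by linarith) (by linarith)
  have hy : (q 0 : ℝ) ^ 2 ≤ (4 * N) ^ 2 := sq_le_sq' (by linarith) (by linarith)
  exact Real.sqrt_le_iff.2 ⟨by linarith, by nlinarith⟩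

theorem card_sdiff_pair (i j : Fin 5) (hi : i ∈ ({1, 2, 3, 4} : Finset (Fin 5)))
    (hj : j ∈ ({1, 2, 3, 4} : Finset (Fin 5))) (hij : i ≠ j) :
    (({1, 2, 3, 4} : Finset (Fin 5)) \ {i, j}).card = 2 := by
  revert i j
  decide

theorem stmt_4 (s : ℝ) (hs : 0 ≤ s) (ε : ℝ) (hε : 0 < ε ∧ ε ≤ 1 / 6)
    (γ : ℝ) (hγ : γ ∈ Set.Ioo (0 : ℝ) 1) :
    ∃ C : ℝ, 0 < C ∧
      ∀ (i j : Fin 5), i ∈ ({1, 2, 3, 4} : Finset (Fin 5)) →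
        j ∈ ({1, 2, 3, 4} : Finset (Fin 5)) → i ≠ j →
        ∀ (ξ : Fin 5 → ℝ) (q : Fin 5 → ℤ),
          ξ 0 = ξ 1 + ξ 2 + ξ 3 + ξ 4 → q 0 = q 1 + q 2 + q 3 + q 4 →
          wnorm (ξ 2) (q 2) ≤ wnorm (ξ 1) (q 1) →
          wnorm (ξ 3) (q 3) ≤ wnorm (ξ 2) (q 2) →
          wnorm (ξ 4) (q 4) ≤ wnorm (ξ 3) (q 3) →
          1 ≤ wnorm (ξ 1) (q 1) →
          γ * wnorm (ξ 1) (q 1) ≤ wnorm (ξ 4) (q 4) →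
          γ * wnorm (ξ 1) (q 1) ^ 2 ≤ |wnorm (ξ i) (q i) ^ 2 - wnorm (ξ j) (q j) ^ 2| →
          |ξ 0| * jb (ξ 0) (q 0) ^ s ≤
            C * (|wnorm (ξ i) (q i) ^ 2 - wnorm (ξ j) (q j) ^ 2| ^ ((1 : ℝ) / 2) *
              jb (ξ i) (q i) ^ s * jb (ξ j) (q j) ^ (-(7 : ℝ) / 54) *
              |ξ 0| ^ ((1 : ℝ) / 6) * jb (ξ 0) (q 0) ^ (-(1 : ℝ) / 3 - ε) *
              ∏ k ∈ ({1, 2, 3, 4} : Finset (Fin 5)) \ {i, j},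
                jb (ξ k) (q k) ^ ((4 : ℝ) / 27 + 2 * ε)) := by
  obtain ⟨hε0, -⟩ := hε
  obtain ⟨hγ0, -⟩ := hγ
  set a : ℝ := (4 : ℝ) / 27 + 2 * ε with ha
  have ha0 : 0 < a := by positivity
  set c : ℝ := γ ^ ((1 : ℝ) / 2) * (γ / 2) ^ s * (2 : ℝ) ^ (-(7 : ℝ) / 54) * ((γ / 2) ^ a) ^ 2
    with hc
  have hc0 : 0 < c := by positivity
  set p : ℝ := 7 / 6 + s + ε with hp
  have hp0 : 0 < p := by positivity
  refine ⟨6 ^ p / c, by positivity, ?_⟩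
  intro i j hi hj hij ξ q hξ hq h21 h32 h43 hN hγ4 hD
  have hle : ∀ k ∈ ({1, 2, 3, 4} : Finset (Fin 5)),
      wnorm (ξ k) (q k) ≤ wnorm (ξ 1) (q 1) ∧
        γ * wnorm (ξ 1) (q 1) ≤ wnorm (ξ k) (q k) := by
    simp only [Finset.mem_insert, Finset.mem_singleton, forall_eq_or_imp, forall_eq]
    refine ⟨⟨?_, ?_⟩, ⟨?_, ?_⟩, ⟨?_, ?_⟩, ?_, ?_⟩ <;> linarith
  set N := wnorm (ξ 1) (q 1)
  have hN0 : 0 < N := by linarith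
  have hJ : jb (ξ 0) (q 0) ≤ 6 * N := jb_sum_four_le hN hξ hq fun k hk => (hle k hk).1
  have hlow : ∀ k ∈ ({1, 2, 3, 4} : Finset (Fin 5)), γ / 2 * N ≤ jb (ξ k) (q k) := fun k hk => by
    linarith [half_wnorm_le_jb (ξ k) (q k), (hle k hk).2]
  set D := |wnorm (ξ i) (q i) ^ 2 - wnorm (ξ j) (q j) ^ 2|
  have hDlow : γ ^ ((1 : ℝ) / 2) * N ≤ D ^ ((1 : ℝ) / 2) := by
    refine le_trans (le_of_eq ?_) (Real.rpow_le_rpow (by positivity) hD (by norm_num))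
    rw [Real.mul_rpow hγ0.le (by positivity), ← Real.sqrt_eq_rpow (N ^ 2), Real.sqrt_sq hN0.le]
  have hilow : (γ / 2) ^ s * N ^ s ≤ jb (ξ i) (q i) ^ s := by
    rw [← Real.mul_rpow (by positivity) hN0.le]
    exact Real.rpow_le_rpow (by positivity) (hlow i hi) hs
  have hjlow : (2 : ℝ) ^ (-(7 : ℝ) / 54) * N ^ (-(7 : ℝ) / 54) ≤
      jb (ξ j) (q j) ^ (-(7 : ℝ) / 54) := by
    rw [← Real.mul_rpow (by norm_num) hN0.le]
    exact Real.rpow_le_rpow_of_nonpos (jb_pos _ _) (jb_le_two_mul hN (hle j hj).1) (by norm_num)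
  set P := ∏ k ∈ ({1, 2, 3, 4} : Finset (Fin 5)) \ {i, j}, jb (ξ k) (q k) ^ a
  have hPlow : ((γ / 2) ^ a * N ^ a) ^ 2 ≤ P := by
    rw [← Real.mul_rpow (by positivity) hN0.le, ← card_sdiff_pair i j hi hj hij,
      ← Finset.prod_const]
    refine Finset.prod_le_prod (fun _ _ => by positivity) fun k hk => ?_
    exact Real.rpow_le_rpow (by positivity) (hlow k (Finset.mem_sdiff.1 hk).1) ha0.le
  have hpow : N * N ^ s * N ^ (-(7 : ℝ) / 54) * (N ^ a) ^ 2 = N ^ (p + 3 * ε) := by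
    nth_rewrite 1 [← Real.rpow_one N]
    rw [← Real.rpow_mul_natCast hN0.le, ← Real.rpow_add hN0, ← Real.rpow_add hN0,
      ← Real.rpow_add hN0]
    congr 1
    push_cast
    rw [ha, hp]
    ring
  have hR : c * N ^ (p + 3 * ε) ≤
      D ^ ((1 : ℝ) / 2) * jb (ξ i) (q i) ^ s * jb (ξ j) (q j) ^ (-(7 : ℝ) / 54) * P := by
    have hi0 := jb_pos (ξ i) (q i)
    have hj0 := jb_pos (ξ j) (q j)
    have hD0 : 0 ≤ D := abs_nonneg _
    calc c * N ^ (p + 3 * ε)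
        = γ ^ ((1 : ℝ) / 2) * N * ((γ / 2) ^ s * N ^ s) *
          ((2 : ℝ) ^ (-(7 : ℝ) / 54) * N ^ (-(7 : ℝ) / 54)) * ((γ / 2) ^ a * N ^ a) ^ 2 := by
          rw [← hpow, hc]
          ring
      _ ≤ _ := by gcongr
  have hJ0 := jb_pos (ξ 0) (q 0)
  have hx := abs_le_jb (ξ 0) (q 0)
  set J := jb (ξ 0) (q 0)
  have hL : |ξ 0| ^ ((5 : ℝ) / 6) * J ^ (s + 1 / 3 + ε) ≤ 6 ^ p * N ^ (p + 3 * ε) := by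
    calc |ξ 0| ^ ((5 : ℝ) / 6) * J ^ (s + 1 / 3 + ε)
        ≤ J ^ ((5 : ℝ) / 6) * J ^ (s + 1 / 3 + ε) := by gcongr
      _ = J ^ p := by
          rw [← Real.rpow_add hJ0, hp]
          ring_nf
      _ ≤ (6 * N) ^ p := by gcongr
      _ = 6 ^ p * N ^ p := Real.mul_rpow (by norm_num) hN0.le
      _ ≤ 6 ^ p * N ^ (p + 3 * ε) := by
          gcongr
          linarith
  have hsplit : |ξ 0| * J ^ s = |ξ 0| ^ ((1 : ℝ) / 6) * J ^ (-(1 : ℝ) / 3 - ε) *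
      (|ξ 0| ^ ((5 : ℝ) / 6) * J ^ (s + 1 / 3 + ε)) := by
    have h1 : |ξ 0| = |ξ 0| ^ ((1 : ℝ) / 6) * |ξ 0| ^ ((5 : ℝ) / 6) := by
      rw [← Real.rpow_add_of_nonneg (abs_nonneg _) (by norm_num) (by norm_num)]
      norm_num
    have h2 : J ^ s = J ^ (-(1 : ℝ) / 3 - ε) * J ^ (s + 1 / 3 + ε) := by
      rw [← Real.rpow_add hJ0]
      ring_nf
    rw [h2]
    nth_rewrite 1 [h1]
    ring
  calc |ξ 0| * J ^ s
      ≤ |ξ 0| ^ ((1 : ℝ) / 6) * J ^ (-(1 : ℝ) / 3 - ε) * (6 ^ p * N ^ (p + 3 * ε)) := by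
        rw [hsplit]
        gcongr
    _ = 6 ^ p / c * (|ξ 0| ^ ((1 : ℝ) / 6) * J ^ (-(1 : ℝ) / 3 - ε) *
        (c * N ^ (p + 3 * ε))) := by
        field_simp
    _ ≤ 6 ^ p / c * (|ξ 0| ^ ((1 : ℝ) / 6) * J ^ (-(1 : ℝ) / 3 - ε) *
        (D ^ ((1 : ℝ) / 2) * jb (ξ i) (q i) ^ s * jb (ξ j) (q j) ^ (-(7 : ℝ) / 54) * P)) := by
        gcongr
    _ = _ := by ring
end

section
/- There exists δ ∈ (0,1) with the following property: for all real numbers ξ₀,…,ξ₄, all integers q₀,…,q₄ satisfying the convolution constraint, and every real number N ≥ 1/δ such that |3ξᵢ² + qᵢ² − N²| ≤ δN² for every i ∈ {0,1,2,3,4}, one has max_{1 ≤ i ≤ 4} |ξᵢ| > δN. -/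
/-- A real `q` for which `3 * x ^ 2 + q ^ 2` is close to `N ^ 2`, with `x` small compared with `N`,
is close to `N` or to `-N`. -/
theorem near_or_near_neg_of_abs_weighted_sub_le {x q N : ℝ} (hN : 0 < N) (hx : |x| ≤ N / 25)
    (h : |3 * x ^ 2 + q ^ 2 - N ^ 2| ≤ 1 / 100 * N ^ 2) :
    (9 / 10 * N ≤ q ∧ q ≤ 11 / 10 * N) ∨ (-(11 / 10 * N) ≤ q ∧ q ≤ -(9 / 10 * N)) := by
  have hx2 : x ^ 2 ≤ (N / 25) ^ 2 := sq_le_sq' (abs_le.mp hx).1 (abs_le.mp hx).2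
  obtain ⟨h₁, h₂⟩ := abs_le.mp h
  have hlow : 9 / 10 * N ≤ |q| :=
    (pow_le_pow_iff_left₀ (by positivity) (by positivity) two_ne_zero).1
      (by rw [sq_abs]; nlinarith [sq_nonneg N])
  have hupp : |q| ≤ 11 / 10 * N :=
    (pow_le_pow_iff_left₀ (by positivity) (by positivity) two_ne_zero).1
      (by rw [sq_abs]; nlinarith [sq_nonneg x, sq_nonneg N])
  rcases abs_cases q with ⟨hq, -⟩ | ⟨hq, -⟩
  · exact Or.inl ⟨by linarith, by linarith⟩
  · exact Or.inr ⟨by linarith, by linarith⟩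

theorem stmt_5 :
    ∃ δ : ℝ, δ ∈ Set.Ioo (0 : ℝ) 1 ∧
      ∀ (ξ₀ ξ₁ ξ₂ ξ₃ ξ₄ : ℝ) (q₀ q₁ q₂ q₃ q₄ : ℤ) (N : ℝ),
        ξ₀ = ξ₁ + ξ₂ + ξ₃ + ξ₄ → q₀ = q₁ + q₂ + q₃ + q₄ →
        1 / δ ≤ N →
        |3 * ξ₀ ^ 2 + (q₀ : ℝ) ^ 2 - N ^ 2| ≤ δ * N ^ 2 →
        |3 * ξ₁ ^ 2 + (q₁ : ℝ) ^ 2 - N ^ 2| ≤ δ * N ^ 2 →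
        |3 * ξ₂ ^ 2 + (q₂ : ℝ) ^ 2 - N ^ 2| ≤ δ * N ^ 2 →
        |3 * ξ₃ ^ 2 + (q₃ : ℝ) ^ 2 - N ^ 2| ≤ δ * N ^ 2 →
        |3 * ξ₄ ^ 2 + (q₄ : ℝ) ^ 2 - N ^ 2| ≤ δ * N ^ 2 →
        δ * N < max (max (max |ξ₁| |ξ₂|) |ξ₃|) |ξ₄| := by
  refine ⟨1 / 100, by norm_num, ?_⟩
  intro ξ₀ ξ₁ ξ₂ ξ₃ ξ₄ q₀ q₁ q₂ q₃ q₄ N hξ hq hN h₀ h₁ h₂ h₃ h₄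
  by_contra! hmax
  obtain ⟨⟨⟨b₁, b₂⟩, b₃⟩, b₄⟩ := by simpa only [max_le_iff] using hmax
  have hNpos : 0 < N := by norm_num at hN; linarith
  have b₀ : |ξ₀| ≤ N / 25 := by
    rw [abs_le] at b₁ b₂ b₃ b₄ ⊢
    constructor <;> linarith only [hξ, b₁, b₂, b₃, b₄]
  have hqR : (q₀ : ℝ) = q₁ + q₂ + q₃ + q₄ := by exact_mod_cast hq
  have small {x : ℝ} (hx : |x| ≤ 1 / 100 * N) : |x| ≤ N / 25 := by linarith only [hx, hNpos]
  have c₀ := near_or_near_neg_of_abs_weighted_sub_le hNpos b₀ h₀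
  have c₁ := near_or_near_neg_of_abs_weighted_sub_le hNpos (small b₁) h₁
  have c₂ := near_or_near_neg_of_abs_weighted_sub_le hNpos (small b₂) h₂
  have c₃ := near_or_near_neg_of_abs_weighted_sub_le hNpos (small b₃) h₃
  have c₄ := near_or_near_neg_of_abs_weighted_sub_le hNpos (small b₄) h₄
  rcases c₀ with c₀ | c₀ <;> rcases c₁ with c₁ | c₁ <;> rcases c₂ with c₂ | c₂ <;>
    rcases c₃ with c₃ | c₃ <;> rcases c₄ with c₄ | c₄ <;>
    linarith only [hNpos, hqR, c₀.1, c₀.2, c₁.1, c₁.2, c₂.1, c₂.2, c₃.1, c₃.2, c₄.1, c₄.2]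
end

section
/- For every ε ∈ (0,1) there exists δ ∈ (0,1) with the following property: for all real numbers ξ₀,…,ξ₄, all integers q₀,…,q₄ satisfying the convolution constraint, and every real number N ≥ 1/δ such that |3ξᵢ² + qᵢ² − N²| ≤ δN² for every i ∈ {0,1,2,3,4} and |ξᵢ| ≤ δN for i ∈ {1,2,3}, one has |q₀| ≥ N/3, |q₄| ≥ N/3, and ||q₀| − |q₄|| ≤ εN. -/
/-- A real number whose square lies in `[1 - 4δ, 1 + δ]` is within `4δ` of `1` or `-1`. -/
lemma abs_sub_one_le_or_abs_add_one_le {δ x a : ℝ} (h₀ : 0 ≤ δ) (h₁ : δ ≤ 1 / 4)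
    (h : |3 * x ^ 2 + a ^ 2 - 1| ≤ δ) (hx : |x| ≤ δ) :
    |a - 1| ≤ 4 * δ ∨ |a + 1| ≤ 4 * δ := by
  rw [abs_le] at h hx
  have hx2 : 3 * x ^ 2 ≤ 3 * δ := by nlinarith
  rcases le_total 0 a with ha | ha
  · left
    rw [abs_le]
    constructor <;> nlinarith
  · right
    rw [abs_le]
    constructor <;> nlinarith

/-- A sum of three numbers close to `±1` has absolute value almost at least `1`. -/
lemma one_sub_le_abs_add_three {η a b c : ℝ}
    (ha : |a - 1| ≤ η ∨ |a + 1| ≤ η) (hb : |b - 1| ≤ η ∨ |b + 1| ≤ η)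
    (hc : |c - 1| ≤ η ∨ |c + 1| ≤ η) : 1 - 3 * η ≤ |a + b + c| := by
  simp only [abs_le] at ha hb hc
  rw [le_abs]
  rcases ha with ha | ha <;> rcases hb with hb | hb <;> rcases hc with hc | hc <;>
    first
    | (left; linarith)
    | (right; linarith)

/-- The resonance estimate after rescaling all frequencies by `N`. -/
lemma third_le_abs_and_abs_sub_abs_le_of_convolution {δ x₀ x₁ x₂ x₃ x₄ a₀ a₁ a₂ a₃ a₄ : ℝ}
    (h₀ : 0 ≤ δ) (hδ : δ ≤ 1 / 1000)
    (hx : x₀ = x₁ + x₂ + x₃ + x₄) (ha : a₀ = a₁ + a₂ + a₃ + a₄)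
    (e₀ : |3 * x₀ ^ 2 + a₀ ^ 2 - 1| ≤ δ) (e₁ : |3 * x₁ ^ 2 + a₁ ^ 2 - 1| ≤ δ)
    (e₂ : |3 * x₂ ^ 2 + a₂ ^ 2 - 1| ≤ δ) (e₃ : |3 * x₃ ^ 2 + a₃ ^ 2 - 1| ≤ δ)
    (e₄ : |3 * x₄ ^ 2 + a₄ ^ 2 - 1| ≤ δ)
    (b₁ : |x₁| ≤ δ) (b₂ : |x₂| ≤ δ) (b₃ : |x₃| ≤ δ) :
    1 / 3 ≤ |a₀| ∧ 1 / 3 ≤ |a₄| ∧ abs (|a₀| - |a₄|) ≤ 40 * δ := by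
  have hS : 1 - 3 * (4 * δ) ≤ |a₁ + a₂ + a₃| :=
    one_sub_le_abs_add_three
      (abs_sub_one_le_or_abs_add_one_le h₀ (by linarith) e₁ b₁)
      (abs_sub_one_le_or_abs_add_one_le h₀ (by linarith) e₂ b₂)
      (abs_sub_one_le_or_abs_add_one_le h₀ (by linarith) e₃ b₃)
  have hS' : a₁ + a₂ + a₃ = a₀ - a₄ := by linarith
  rw [hS'] at hS
  rw [abs_le] at e₀ e₄ b₁ b₂ b₃
  have hx₀ : |x₀| ≤ 1 := abs_le_one_iff_mul_self_le_one.2 (by nlinarith [sq_nonneg a₀])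
  have hx₄ : |x₄| ≤ 1 := abs_le_one_iff_mul_self_le_one.2 (by nlinarith [sq_nonneg a₄])
  have hd : |x₀ - x₄| ≤ 3 * δ := abs_le.2 ⟨by linarith, by linarith⟩
  have hs : |x₀ + x₄| ≤ 2 := (abs_add_le _ _).trans (by linarith)
  have hxx : |(x₀ - x₄) * (x₀ + x₄)| ≤ 3 * δ * 2 := by
    rw [abs_mul]
    gcongr
  rw [abs_le] at hxx
  have haa : |a₀ - a₄| * |a₀ + a₄| ≤ 20 * δ := by
    rw [← abs_mul, abs_le]
    constructor <;> nlinarith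
  have hsum : |a₀ + a₄| ≤ 40 * δ := by nlinarith [abs_nonneg (a₀ + a₄)]
  have hdiff : abs (|a₀| - |a₄|) ≤ 40 * δ := by
    have := abs_abs_sub_abs_le_abs_sub a₀ (-a₄)
    rw [abs_neg, sub_neg_eq_add] at this
    exact this.trans hsum
  have htri : |a₀ - a₄| ≤ |a₀| + |a₄| := abs_sub _ _
  have hdiff' := abs_le.1 hdiff
  exact ⟨by linarith, by linarith, hdiff⟩

theorem stmt_6 (ε : ℝ) (hε : ε ∈ Set.Ioo (0 : ℝ) 1) :
    ∃ δ : ℝ, δ ∈ Set.Ioo (0 : ℝ) 1 ∧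
      ∀ (ξ₀ ξ₁ ξ₂ ξ₃ ξ₄ : ℝ) (q₀ q₁ q₂ q₃ q₄ : ℤ) (N : ℝ),
        ξ₀ = ξ₁ + ξ₂ + ξ₃ + ξ₄ → q₀ = q₁ + q₂ + q₃ + q₄ →
        1 / δ ≤ N →
        |3 * ξ₀ ^ 2 + (q₀ : ℝ) ^ 2 - N ^ 2| ≤ δ * N ^ 2 →
        |3 * ξ₁ ^ 2 + (q₁ : ℝ) ^ 2 - N ^ 2| ≤ δ * N ^ 2 →
        |3 * ξ₂ ^ 2 + (q₂ : ℝ) ^ 2 - N ^ 2| ≤ δ * N ^ 2 →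
        |3 * ξ₃ ^ 2 + (q₃ : ℝ) ^ 2 - N ^ 2| ≤ δ * N ^ 2 →
        |3 * ξ₄ ^ 2 + (q₄ : ℝ) ^ 2 - N ^ 2| ≤ δ * N ^ 2 →
        |ξ₁| ≤ δ * N → |ξ₂| ≤ δ * N → |ξ₃| ≤ δ * N →
        N / 3 ≤ |(q₀ : ℝ)| ∧ N / 3 ≤ |(q₄ : ℝ)| ∧ abs (|(q₀ : ℝ)| - |(q₄ : ℝ)|) ≤ ε * N := by
  obtain ⟨hε₀, hε₁⟩ := hε
  refine ⟨ε / 1000, ⟨by linarith, by linarith⟩, ?_⟩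
  intro ξ₀ ξ₁ ξ₂ ξ₃ ξ₄ q₀ q₁ q₂ q₃ q₄ N hξ hq hN e₀ e₁ e₂ e₃ e₄ b₁ b₂ b₃
  have hN₀ : 0 < N := lt_of_lt_of_le (by positivity) hN
  have scale_sq {ξ q : ℝ} (h : |3 * ξ ^ 2 + q ^ 2 - N ^ 2| ≤ ε / 1000 * N ^ 2) :
      |3 * (ξ / N) ^ 2 + (q / N) ^ 2 - 1| ≤ ε / 1000 := by
    have : 3 * (ξ / N) ^ 2 + (q / N) ^ 2 - 1 = (3 * ξ ^ 2 + q ^ 2 - N ^ 2) / N ^ 2 := by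
      field_simp
    rwa [this, abs_div, abs_of_pos (pow_pos hN₀ 2), div_le_iff₀ (pow_pos hN₀ 2)]
  have abs_scale (t : ℝ) : |t / N| = |t| / N := by rw [abs_div, abs_of_pos hN₀]
  have scale_le {ξ : ℝ} (h : |ξ| ≤ ε / 1000 * N) : |ξ / N| ≤ ε / 1000 := by
    rwa [abs_scale, div_le_iff₀ hN₀]
  have hx : ξ₀ / N = ξ₁ / N + ξ₂ / N + ξ₃ / N + ξ₄ / N := by rw [hξ]; ring
  have ha : (q₀ : ℝ) / N = q₁ / N + q₂ / N + q₃ / N + q₄ / N := by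
    rw [hq]; push_cast; ring
  obtain ⟨c₀, c₄, hc⟩ := third_le_abs_and_abs_sub_abs_le_of_convolution
    (by positivity) (by linarith) hx ha
    (scale_sq e₀) (scale_sq e₁) (scale_sq e₂) (scale_sq e₃) (scale_sq e₄)
    (scale_le b₁) (scale_le b₂) (scale_le b₃)
  rw [abs_scale, le_div_iff₀ hN₀] at c₀ c₄
  rw [abs_scale, abs_scale, ← sub_div, abs_scale, div_le_iff₀ hN₀] at hc
  refine ⟨by linarith, by linarith, hc.trans ?_⟩
  gcongr
  linarith
end

section
/- For every γ ∈ (0,1) there exists δ ∈ (0,1) with the following property: for all real numbers ξ₁, ξ₄, all integers q₁, q₄, and every real number N ≥ 1/δ such that |3ξ₁² + q₁² − N²| ≤ δN², |3ξ₄² + q₄² − N²| ≤ δN², |ξ₁| ≤ δN, |ξ₄| ≥ γN, |q₄| ≥ N/4, and q₁ · q₄ > 0, one has (q₁ + q₄)² − 3(ξ₁ + ξ₄)² ≥ N²/2 and |ξ₁ + ξ₄| ≥ γN/2. -/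
theorem stmt_8 (γ : ℝ) (hγ : γ ∈ Set.Ioo (0 : ℝ) 1) :
    ∃ δ : ℝ, δ ∈ Set.Ioo (0 : ℝ) 1 ∧
      ∀ (ξ₁ ξ₄ : ℝ) (q₁ q₄ : ℤ) (N : ℝ),
        1 / δ ≤ N →
        |3 * ξ₁ ^ 2 + (q₁ : ℝ) ^ 2 - N ^ 2| ≤ δ * N ^ 2 →
        |3 * ξ₄ ^ 2 + (q₄ : ℝ) ^ 2 - N ^ 2| ≤ δ * N ^ 2 →
        |ξ₁| ≤ δ * N → γ * N ≤ |ξ₄| → N / 4 ≤ |(q₄ : ℝ)| →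
        q₁ * q₄ > 0 →
        N ^ 2 / 2 ≤ ((q₁ : ℝ) + (q₄ : ℝ)) ^ 2 - 3 * (ξ₁ + ξ₄) ^ 2 ∧
        γ * N / 2 ≤ |ξ₁ + ξ₄| := by
  obtain ⟨hγ0, hγ1⟩ := hγ
  refine ⟨γ / 200, ⟨by linarith, by linarith⟩, ?_⟩
  intro ξ₁ ξ₄ q₁ q₄ N hN h₁ h₄ hξ₁ hξ₄ hq₄ hq
  have hN0 : 0 < N := lt_of_lt_of_le (by positivity) hN
  have hγN : 0 < γ * N := mul_pos hγ0 hN0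
  have hδN : γ / 200 * N ≤ N / 200 := by nlinarith
  have hδN2 : γ / 200 * N ^ 2 ≤ N ^ 2 / 200 := by nlinarith [pow_pos hN0 2]
  have hprod : (q₁ : ℝ) * q₄ = |(q₁ : ℝ)| * |(q₄ : ℝ)| := by
    rw [← abs_mul, abs_of_pos (by exact_mod_cast hq)]
  have hξ₁N : |ξ₁| ≤ N / 200 := hξ₁.trans hδN
  have hξ₁sq : ξ₁ ^ 2 ≤ (N / 200) ^ 2 := sq_le_sq' (abs_le.mp hξ₁N).1 (abs_le.mp hξ₁N).2
  have hq₁ : 99 / 100 * N ≤ |(q₁ : ℝ)| := by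
    refine le_of_pow_le_pow_left₀ two_ne_zero (abs_nonneg _) ?_
    rw [sq_abs]
    nlinarith [(abs_le.mp h₁).1, pow_pos hN0 2]
  have hq₄sq : (N / 4) ^ 2 ≤ (q₄ : ℝ) ^ 2 := by
    rw [← sq_abs (q₄ : ℝ)]
    gcongr
  have hξ₄N : |ξ₄| ≤ N := by
    refine le_of_pow_le_pow_left₀ two_ne_zero hN0.le ?_
    rw [sq_abs]
    nlinarith [(abs_le.mp h₄).2, pow_pos hN0 2]
  have hcross : ξ₁ * ξ₄ ≤ N / 200 * N :=
    (le_abs_self _).trans (by rw [abs_mul]; gcongr)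
  have hqq : 99 / 100 * N * (N / 4) ≤ |(q₁ : ℝ)| * |(q₄ : ℝ)| := by gcongr
  constructor
  · nlinarith [(abs_le.mp h₁).1, (abs_le.mp h₄).2, pow_pos hN0 2]
  · have := abs_sub_abs_le_abs_sub ξ₄ (-ξ₁)
    rw [abs_neg, sub_neg_eq_add, add_comm ξ₄] at this
    linarith
end

section
/- There exist δ ∈ (0,1) and c ∈ (0,1) with the following property: for all real numbers ξ₀,…,ξ₄, all integers q₀,…,q₄ satisfying the convolution constraint, and every real number N ≥ 1/δ such that |3ξᵢ² + qᵢ² − N²| ≤ δN² for every i ∈ {0,1,2,3,4} and |ξᵢ| ≤ δN for i ∈ {1,2,3}, there exists an index j ∈ {1,2,3} such that qⱼ · q₄ > 0, |3(ξⱼ + ξ₄)² − (qⱼ + q₄)²| ≥ cN², and |ξⱼ + ξ₄| ≥ cN. -/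
/-- A point near the ellipse `3 x ^ 2 + y ^ 2 = 1` with small `x` has `y` close to `1` or
to `-1`. -/
lemma near_one_or_near_neg_one {x y : ℝ} (hx : |x| ≤ 1 / 1000)
    (h : |3 * x ^ 2 + y ^ 2 - 1| ≤ 1 / 1000) :
    |y - 1| ≤ 1 / 500 ∨ |y + 1| ≤ 1 / 500 := by
  rw [abs_le] at hx h
  have hx2 : x ^ 2 ≤ 1 / 1000000 := by nlinarith
  have hx0 := sq_nonneg x
  rcases le_total 0 y with hy | hy
  · left
    rw [abs_le]
    constructor <;> nlinarith
  · right
    rw [abs_le]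
    constructor <;> nlinarith

/-- Two points near the ellipse `3 x ^ 2 + y ^ 2 = 1` that differ by almost `(0, 1)` lie near
`y = -1 / 2` and `y = 1 / 2`; adding a point near `(0, -1)` to the lower one gives a point away
from both the cone `3 x ^ 2 = y ^ 2` and the line `x = 0`. -/
lemma pair_of_shift_near_one {x y e s a b : ℝ} (he : |e| ≤ 3 / 1000) (hs : |s - 1| ≤ 6 / 1000)
    (ha : |a| ≤ 1 / 1000) (hb : |b + 1| ≤ 1 / 500)
    (h : |3 * x ^ 2 + y ^ 2 - 1| ≤ 1 / 1000)
    (h' : |3 * (e + x) ^ 2 + (s + y) ^ 2 - 1| ≤ 1 / 1000) :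
    0 < b * y ∧ 1 / 10 ≤ |3 * (a + x) ^ 2 - (b + y) ^ 2| ∧ 1 / 10 ≤ |a + x| := by
  rw [abs_le] at he hs ha hb h h'
  have hx : |x| ≤ 3 / 5 := abs_le_of_sq_le_sq (by nlinarith [sq_nonneg y]) (by norm_num)
  have hy : |y| ≤ 101 / 100 := abs_le_of_sq_le_sq (by nlinarith [sq_nonneg x]) (by norm_num)
  rw [abs_le] at hx hy
  have hex : |e * x| ≤ 18 / 10000 := by
    rw [abs_mul]
    calc |e| * |x| ≤ (3 / 1000) * (3 / 5) := by
          gcongr <;> exact abs_le.2 (by assumption)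
      _ = 18 / 10000 := by norm_num
  have hsy : |(s - 1) * y| ≤ 606 / 100000 := by
    rw [abs_mul]
    calc |s - 1| * |y| ≤ (6 / 1000) * (101 / 100) := by
          gcongr <;> exact abs_le.2 (by assumption)
      _ = 606 / 100000 := by norm_num
  rw [abs_le] at hex hsy
  have he2 : e ^ 2 ≤ 1 / 100000 := by nlinarith only [he]
  have he0 := sq_nonneg e
  have hs2 : (s - 1) ^ 2 ≤ 36 / 1000000 := by nlinarith only [hs]
  have hs0 := sq_nonneg (s - 1)
  have hyl : -(53 / 100) ≤ y := by linarith
  have hyu : y ≤ -(47 / 100) := by linarith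
  have hy2l : 22 / 100 ≤ y ^ 2 := by nlinarith only [hyu]
  have hy2u : y ^ 2 ≤ 282 / 1000 := by nlinarith only [hyl, hyu]
  have hax : |a * x| ≤ 6 / 10000 := by
    rw [abs_mul]
    calc |a| * |x| ≤ (1 / 1000) * (3 / 5) := by
          gcongr <;> exact abs_le.2 (by assumption)
      _ = 6 / 10000 := by norm_num
  rw [abs_le] at hax
  have ha2 : a ^ 2 ≤ 1 / 1000000 := by nlinarith only [ha]
  have ha0 := sq_nonneg a
  refine ⟨by nlinarith only [hb, hyu], ?_, ?_⟩
  · have hby : 2 ≤ (b + y) ^ 2 := by nlinarith only [hb, hyu]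
    exact le_abs.2 (Or.inr (by linarith))
  · refine (pow_le_pow_iff_left₀ (by norm_num) (abs_nonneg _) two_ne_zero).1 ?_
    rw [sq_abs]
    linarith

/-- Normalized form of the structural lemma, on the unit ellipse. -/
lemma exists_pair_of_near_unit_ellipse (x y : Fin 5 → ℝ)
    (hx : x 0 = x 1 + x 2 + x 3 + x 4) (hy : y 0 = y 1 + y 2 + y 3 + y 4)
    (h : ∀ i, |3 * x i ^ 2 + y i ^ 2 - 1| ≤ 1 / 1000)
    (h1 : |x 1| ≤ 1 / 1000) (h2 : |x 2| ≤ 1 / 1000) (h3 : |x 3| ≤ 1 / 1000) :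
    ∃ j : Fin 5, j ∈ ({1, 2, 3} : Finset (Fin 5)) ∧ 0 < y j * y 4 ∧
      1 / 10 ≤ |3 * (x j + x 4) ^ 2 - (y j + y 4) ^ 2| ∧ 1 / 10 ≤ |x j + x 4| := by
  have he : |x 1 + x 2 + x 3| ≤ 3 / 1000 := by
    rw [abs_le] at *
    constructor <;> linarith
  have h0 := h 0
  rw [hx, hy] at h0
  have h4 := h 4
  have hy4 : |y 4| ≤ 101 / 100 :=
    abs_le_of_sq_le_sq (by nlinarith [sq_nonneg (x 4), (abs_le.1 h4).2]) (by norm_num)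
  have hy0 : |y 1 + y 2 + y 3 + y 4| ≤ 101 / 100 :=
    abs_le_of_sq_le_sq
      (by nlinarith [sq_nonneg (x 1 + x 2 + x 3 + x 4), (abs_le.1 h0).2]) (by norm_num)
  have pos : ∀ j : Fin 5, j ∈ ({1, 2, 3} : Finset (Fin 5)) → |x j| ≤ 1 / 1000 →
      |y 1 + y 2 + y 3 - 1| ≤ 6 / 1000 → |y j + 1| ≤ 1 / 500 →
      ∃ j : Fin 5, j ∈ ({1, 2, 3} : Finset (Fin 5)) ∧ 0 < y j * y 4 ∧
        1 / 10 ≤ |3 * (x j + x 4) ^ 2 - (y j + y 4) ^ 2| ∧ 1 / 10 ≤ |x j + x 4| :=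
    fun j hj hxj hs hyj => ⟨j, hj, pair_of_shift_near_one he hs hxj hyj h4 h0⟩
  have neg : ∀ j : Fin 5, j ∈ ({1, 2, 3} : Finset (Fin 5)) → |x j| ≤ 1 / 1000 →
      |y 1 + y 2 + y 3 + 1| ≤ 6 / 1000 → |y j - 1| ≤ 1 / 500 →
      ∃ j : Fin 5, j ∈ ({1, 2, 3} : Finset (Fin 5)) ∧ 0 < y j * y 4 ∧
        1 / 10 ≤ |3 * (x j + x 4) ^ 2 - (y j + y 4) ^ 2| ∧ 1 / 10 ≤ |x j + x 4| := by
    intro j hj hxj hs hyj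
    have key := pair_of_shift_near_one (x := x 4) (y := -y 4) (s := -(y 1 + y 2 + y 3))
      (b := -y j) he (by rw [← abs_neg]; convert hs using 2; ring) hxj
      (by rw [← abs_neg]; convert hyj using 2; ring) (by simpa using h4)
      (by convert h0 using 2; ring)
    refine ⟨j, hj, by simpa using key.1, ?_, key.2.2⟩
    convert key.2.1 using 2
    ring
  rcases near_one_or_near_neg_one h1 (h 1) with k1 | k1 <;>
  rcases near_one_or_near_neg_one h2 (h 2) with k2 | k2 <;>
  rcases near_one_or_near_neg_one h3 (h 3) with k3 | k3 <;>
  have l1 := abs_le.1 k1 <;> have l2 := abs_le.1 k2 <;> have l3 := abs_le.1 k3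
  · rw [abs_le] at hy4 hy0
    linarith
  · exact pos 3 (by decide) h3 (by rw [abs_le]; constructor <;> linarith) k3
  · exact pos 2 (by decide) h2 (by rw [abs_le]; constructor <;> linarith) k2
  · exact neg 1 (by decide) h1 (by rw [abs_le]; constructor <;> linarith) k1
  · exact pos 1 (by decide) h1 (by rw [abs_le]; constructor <;> linarith) k1
  · exact neg 2 (by decide) h2 (by rw [abs_le]; constructor <;> linarith) k2
  · exact neg 3 (by decide) h3 (by rw [abs_le]; constructor <;> linarith) k3
  · rw [abs_le] at hy4 hy0
    linarith

theorem stmt_9 :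
    ∃ δ : ℝ, δ ∈ Set.Ioo (0 : ℝ) 1 ∧ ∃ c : ℝ, c ∈ Set.Ioo (0 : ℝ) 1 ∧
      ∀ (ξ : Fin 5 → ℝ) (q : Fin 5 → ℤ) (N : ℝ),
        ξ 0 = ξ 1 + ξ 2 + ξ 3 + ξ 4 → q 0 = q 1 + q 2 + q 3 + q 4 →
        1 / δ ≤ N →
        (∀ i : Fin 5, |3 * ξ i ^ 2 + (q i : ℝ) ^ 2 - N ^ 2| ≤ δ * N ^ 2) →
        |ξ 1| ≤ δ * N → |ξ 2| ≤ δ * N → |ξ 3| ≤ δ * N →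
        ∃ j : Fin 5, j ∈ ({1, 2, 3} : Finset (Fin 5)) ∧
          q j * q 4 > 0 ∧
          c * N ^ 2 ≤ |3 * (ξ j + ξ 4) ^ 2 - ((q j : ℝ) + (q 4 : ℝ)) ^ 2| ∧
          c * N ≤ |ξ j + ξ 4| := by
  refine ⟨1 / 1000, by norm_num, 1 / 10, by norm_num, ?_⟩
  intro ξ q N hξ hq hN h h1 h2 h3
  have hN0 : 0 < N := lt_of_lt_of_le (by norm_num) hN
  have small : ∀ i, |ξ i| ≤ 1 / 1000 * N → |ξ i / N| ≤ 1 / 1000 := fun i hi => by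
    rwa [abs_div, abs_of_pos hN0, div_le_iff₀ hN0]
  obtain ⟨j, hj, hpos, hcone, hline⟩ := exists_pair_of_near_unit_ellipse
    (fun i => ξ i / N) (fun i => q i / N) (by simp only [hξ]; ring)
    (by simp only [hq]; push_cast; ring)
    (fun i => by
      have e : 3 * (ξ i / N) ^ 2 + ((q i : ℝ) / N) ^ 2 - 1 =
          (3 * ξ i ^ 2 + (q i : ℝ) ^ 2 - N ^ 2) / N ^ 2 := by field_simp
      rw [e, abs_div, abs_of_pos (pow_pos hN0 2), div_le_iff₀ (pow_pos hN0 2)]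
      exact h i)
    (small 1 h1) (small 2 h2) (small 3 h3)
  refine ⟨j, hj, ?_, ?_, ?_⟩
  · have e : (q j : ℝ) / N * (q 4 / N) = (q j * q 4 : ℝ) / N ^ 2 := by field_simp
    rw [e, div_pos_iff_of_pos_right (pow_pos hN0 2)] at hpos
    exact_mod_cast hpos
  · have e : 3 * (ξ j / N + ξ 4 / N) ^ 2 - ((q j : ℝ) / N + q 4 / N) ^ 2 =
        (3 * (ξ j + ξ 4) ^ 2 - ((q j : ℝ) + q 4) ^ 2) / N ^ 2 := by field_simp
    rwa [e, abs_div, abs_of_pos (pow_pos hN0 2), le_div_iff₀ (pow_pos hN0 2)] at hcone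
  · rwa [← add_div, abs_div, abs_of_pos hN0, le_div_iff₀ hN0] at hline
end

section
/- For every s ≥ 0, every ε ∈ (0, 1/6] and every γ ∈ (0,1) there exists C > 0 with the following property: for all real numbers ξ₀,…,ξ₄, all integers q₀,…,q₄ satisfying the convolution constraint, and every real number N ≥ 1 such that γN ≤ |(ξᵢ,qᵢ)| ≤ N for every i ∈ {1,2,3,4} and |ξ₁ + ξ₄| ≥ γN, one has |ξ₀| ⟨(ξ₀,q₀)⟩^s ≤ C · |ξ₁ + ξ₄|^(1/4) ⟨(ξ₁,q₁)⟩^(s−ε) ⟨(ξ₄,q₄)⟩^(49/108+2ε) · |ξ₀|^(1/6) ⟨(ξ₀,q₀)⟩^(−1/3−ε) ⟨(ξ₂,q₂)⟩^(25/108+2ε) ⟨(ξ₃,q₃)⟩^(25/108+2ε). -/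
theorem exists_mul_rpow_le {a b : ℝ} (ha : 0 < a) (hb : 0 < b) (p : ℝ) :
    ∃ c : ℝ, 0 < c ∧ ∀ N x : ℝ, 0 < N → a * N ≤ x → x ≤ b * N → c * N ^ p ≤ x ^ p := by
  rcases le_total 0 p with hp | hp
  · refine ⟨a ^ p, by positivity, fun N x hN h _ => ?_⟩
    rw [← Real.mul_rpow ha.le hN.le]
    exact Real.rpow_le_rpow (by positivity) h hp
  · refine ⟨b ^ p, by positivity, fun N x hN h h' => ?_⟩
    rw [← Real.mul_rpow hb.le hN.le]
    exact Real.rpow_le_rpow_of_nonpos (lt_of_lt_of_le (by positivity) h) h' hp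

theorem abs_intCast_le_wnorm (ξ : ℝ) (q : ℤ) : |(q : ℝ)| ≤ wnorm ξ q :=
  Real.abs_le_sqrt (by nlinarith [sq_nonneg ξ])

theorem jb_le_one_add (ξ : ℝ) (q : ℤ) : jb ξ q ≤ 1 + |ξ| + |(q : ℝ)| := by
  refine Real.sqrt_le_iff.2 ⟨by positivity, ?_⟩
  nlinarith [sq_abs ξ, sq_abs (q : ℝ), abs_nonneg ξ, abs_nonneg (q : ℝ),
    mul_nonneg (abs_nonneg ξ) (abs_nonneg (q : ℝ))]

theorem jb_le_three_mul {ξ N : ℝ} {q : ℤ} (hN : 1 ≤ N) (h : wnorm ξ q ≤ N) :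
    jb ξ q ≤ 3 * N := by
  linarith [jb_le_one_add ξ q, abs_le_wnorm ξ q, abs_intCast_le_wnorm ξ q]

theorem abs_add_four_le {a b c d N : ℝ} (ha : |a| ≤ N) (hb : |b| ≤ N) (hc : |c| ≤ N)
    (hd : |d| ≤ N) : |a + b + c + d| ≤ 4 * N := by
  rw [abs_le] at *
  constructor <;> linarith

/-- Trading powers of `x ≤ y` for powers of `y`. -/
theorem mul_rpow_le_of_le {x y : ℝ} (hx : 0 < x) (hxy : x ≤ y) (s ε : ℝ) :
    x * y ^ s ≤ x ^ ((1 : ℝ) / 6) * y ^ (-(1 : ℝ) / 3 - ε) * y ^ (s + 7 / 6 + ε) := by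
  have hy : 0 < y := hx.trans_le hxy
  have h : x = x ^ ((1 : ℝ) / 6) * x ^ ((5 : ℝ) / 6) := by
    rw [← Real.rpow_add hx]; norm_num
  calc x * y ^ s = x ^ ((1 : ℝ) / 6) * x ^ ((5 : ℝ) / 6) * y ^ s := by rw [← h]
    _ ≤ x ^ ((1 : ℝ) / 6) * y ^ ((5 : ℝ) / 6) * y ^ s := by gcongr
    _ = _ := by
      rw [mul_assoc, mul_assoc, ← Real.rpow_add hy, ← Real.rpow_add hy]
      ring_nf

theorem stmt_10 (s : ℝ) (hs : 0 ≤ s) (ε : ℝ) (hε : 0 < ε ∧ ε ≤ 1 / 6)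
    (γ : ℝ) (hγ : γ ∈ Set.Ioo (0 : ℝ) 1) :
    ∃ C : ℝ, 0 < C ∧
      ∀ (ξ₀ ξ₁ ξ₂ ξ₃ ξ₄ : ℝ) (q₀ q₁ q₂ q₃ q₄ : ℤ) (N : ℝ),
        ξ₀ = ξ₁ + ξ₂ + ξ₃ + ξ₄ → q₀ = q₁ + q₂ + q₃ + q₄ →
        1 ≤ N →
        γ * N ≤ wnorm ξ₁ q₁ → wnorm ξ₁ q₁ ≤ N →
        γ * N ≤ wnorm ξ₂ q₂ → wnorm ξ₂ q₂ ≤ N →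
        γ * N ≤ wnorm ξ₃ q₃ → wnorm ξ₃ q₃ ≤ N →
        γ * N ≤ wnorm ξ₄ q₄ → wnorm ξ₄ q₄ ≤ N →
        γ * N ≤ |ξ₁ + ξ₄| →
        |ξ₀| * jb ξ₀ q₀ ^ s ≤
          C * (|ξ₁ + ξ₄| ^ ((1 : ℝ) / 4) * jb ξ₁ q₁ ^ (s - ε) *
            jb ξ₄ q₄ ^ ((49 : ℝ) / 108 + 2 * ε) *
            |ξ₀| ^ ((1 : ℝ) / 6) * jb ξ₀ q₀ ^ (-(1 : ℝ) / 3 - ε) *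
            jb ξ₂ q₂ ^ ((25 : ℝ) / 108 + 2 * ε) *
            jb ξ₃ q₃ ^ ((25 : ℝ) / 108 + 2 * ε)) := by
  obtain ⟨hε, -⟩ := hε
  obtain ⟨hγ, -⟩ := hγ
  have hγ2 : 0 < γ / 2 := by positivity
  obtain ⟨c₀, hc₀, H₀⟩ := exists_mul_rpow_le hγ two_pos ((1 : ℝ) / 4)
  obtain ⟨c₁, hc₁, H₁⟩ := exists_mul_rpow_le hγ2 three_pos (s - ε)
  obtain ⟨c₄, hc₄, H₄⟩ := exists_mul_rpow_le hγ2 three_pos ((49 : ℝ) / 108 + 2 * ε)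
  obtain ⟨c₂, hc₂, H₂⟩ := exists_mul_rpow_le hγ2 three_pos ((25 : ℝ) / 108 + 2 * ε)
  refine ⟨9 ^ (s + 7 / 6 + ε) / (c₀ * c₁ * c₄ * c₂ * c₂), by positivity, ?_⟩
  intro ξ₀ ξ₁ ξ₂ ξ₃ ξ₄ q₀ q₁ q₂ q₃ q₄ N hξ hq hN l₁ u₁ l₂ u₂ l₃ u₃ l₄ u₄ hl
  have hN0 : 0 < N := one_pos.trans_le hN
  have lower {ξ : ℝ} {q : ℤ} (h : γ * N ≤ wnorm ξ q) : γ / 2 * N ≤ jb ξ q := by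
    linarith [wnorm_le_two_mul_jb ξ q]
  have abs_le {ξ : ℝ} {q : ℤ} (h : wnorm ξ q ≤ N) : |ξ| ≤ N := (abs_le_wnorm ξ q).trans h
  have abs_le' {ξ : ℝ} {q : ℤ} (h : wnorm ξ q ≤ N) : |(q : ℝ)| ≤ N :=
    (abs_intCast_le_wnorm ξ q).trans h
  have k₀ := H₀ N |ξ₁ + ξ₄| hN0 hl (by linarith [abs_add_le ξ₁ ξ₄, abs_le u₁, abs_le u₄])
  have k₁ := H₁ N _ hN0 (lower l₁) (jb_le_three_mul hN u₁)
  have k₄ := H₄ N _ hN0 (lower l₄) (jb_le_three_mul hN u₄)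
  have k₂ := H₂ N _ hN0 (lower l₂) (jb_le_three_mul hN u₂)
  have k₃ := H₂ N _ hN0 (lower l₃) (jb_le_three_mul hN u₃)
  have hJ : jb ξ₀ q₀ ≤ 9 * N := by
    have h₁ := abs_add_four_le (abs_le u₁) (abs_le u₂) (abs_le u₃) (abs_le u₄)
    have h₂ := abs_add_four_le (abs_le' u₁) (abs_le' u₂) (abs_le' u₃) (abs_le' u₄)
    have h₃ := jb_le_one_add ξ₀ q₀
    rw [hξ, hq] at h₃ ⊢
    push_cast at h₃
    linarith
  have p₀ := jb_pos ξ₀ q₀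
  have p₁ := jb_pos ξ₁ q₁
  have p₂ := jb_pos ξ₂ q₂
  have p₃ := jb_pos ξ₃ q₃
  have p₄ := jb_pos ξ₄ q₄
  rcases (abs_nonneg ξ₀).eq_or_lt with h0 | h0
  · rw [← h0, zero_mul]
    positivity
  have hpow : N ^ (s + 7 / 6 + ε) ≤ N ^ ((1 : ℝ) / 4) * N ^ (s - ε) *
      N ^ ((49 : ℝ) / 108 + 2 * ε) * N ^ ((25 : ℝ) / 108 + 2 * ε) *
      N ^ ((25 : ℝ) / 108 + 2 * ε) := by
    simp only [← Real.rpow_add hN0]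
    exact Real.rpow_le_rpow_of_exponent_le hN (by linarith)
  have hprod : (c₀ * c₁ * c₄ * c₂ * c₂) * N ^ (s + 7 / 6 + ε) ≤
      |ξ₁ + ξ₄| ^ ((1 : ℝ) / 4) * jb ξ₁ q₁ ^ (s - ε) * jb ξ₄ q₄ ^ ((49 : ℝ) / 108 + 2 * ε) *
        jb ξ₂ q₂ ^ ((25 : ℝ) / 108 + 2 * ε) * jb ξ₃ q₃ ^ ((25 : ℝ) / 108 + 2 * ε) :=
    calc _ ≤ (c₀ * c₁ * c₄ * c₂ * c₂) * _ := mul_le_mul_of_nonneg_left hpow (by positivity)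
      _ = (c₀ * N ^ ((1 : ℝ) / 4)) * (c₁ * N ^ (s - ε)) *
          (c₄ * N ^ ((49 : ℝ) / 108 + 2 * ε)) * (c₂ * N ^ ((25 : ℝ) / 108 + 2 * ε)) *
          (c₂ * N ^ ((25 : ℝ) / 108 + 2 * ε)) := by ring
      _ ≤ _ := by gcongr
  have hJpow : jb ξ₀ q₀ ^ (s + 7 / 6 + ε) ≤ 9 ^ (s + 7 / 6 + ε) * N ^ (s + 7 / 6 + ε) := by
    rw [← Real.mul_rpow (by norm_num) hN0.le]
    exact Real.rpow_le_rpow p₀.le hJ (by positivity)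
  refine (mul_rpow_le_of_le h0 (abs_le_jb ξ₀ q₀) s ε).trans ?_
  calc _ ≤ |ξ₀| ^ ((1 : ℝ) / 6) * jb ξ₀ q₀ ^ (-(1 : ℝ) / 3 - ε) *
        (9 ^ (s + 7 / 6 + ε) * N ^ (s + 7 / 6 + ε)) := by gcongr
    _ = |ξ₀| ^ ((1 : ℝ) / 6) * jb ξ₀ q₀ ^ (-(1 : ℝ) / 3 - ε) *
        (9 ^ (s + 7 / 6 + ε) / (c₀ * c₁ * c₄ * c₂ * c₂) *
          ((c₀ * c₁ * c₄ * c₂ * c₂) * N ^ (s + 7 / 6 + ε))) := by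
      rw [← mul_assoc (_ / _), div_mul_cancel₀ _ (by positivity)]
    _ ≤ |ξ₀| ^ ((1 : ℝ) / 6) * jb ξ₀ q₀ ^ (-(1 : ℝ) / 3 - ε) *
        (9 ^ (s + 7 / 6 + ε) / (c₀ * c₁ * c₄ * c₂ * c₂) * _) :=
      mul_le_mul_of_nonneg_left (mul_le_mul_of_nonneg_left hprod (by positivity)) (by positivity)
    _ = _ := by ring
end
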